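/- Let C~, C~′, C~″ be r-perfect S-complexes over a commutative ring R. Let (λ, μ, Δ₁, Δ₂, τ₀, τ₋₁) be height −1 morphism data from C~ to C~′, i.e. R-linear maps λ, μ: C → C′, Δ₁: C → 𝖱′, Δ₂: 𝖱 → C′, τ₀, τ₋₁: 𝖱 → 𝖱′ (of degrees k, k−1, k, k−1, k, k+2 for some even k) satisfying d′λ − λd − δ₂′τ₋₁δ₁ = 0, −δ₁′λ + Δ₁d + τ₋₁δ₁v + τ₀δ₁ = 0, λδ₂ + d′Δ₂ − v′δ₂′τ₋₁ − δ₂′τ₀ = 0, and μd + d′μ + λv − v′λ + Δ₂δ₁ − δ₂′Δ₁ = 0, and let λ~₁: C~ → ΣC~′ be the block matrix [[λ, 0, 0], [τ₋₁δ₁, 0, 0], [μ, λ, Δ₂], [Δ₁, τ₋₁δ₁, τ₀], [0, 0, τ₋₁]]. Let λ~′: C~′ → C~″ be a morphism of odd degree with components (λ′, μ′, Δ₁′, Δ₂′, ρ′) satisfying ρ′ = 0, δ₁″Δ₂′ = 0 and Δ₁′δ₂′ = 0 (automatic from the odd degree and r-perfectness), let ν′: 𝖱′ → 𝖱″ be an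 arbitrary R-linear map of degree one less than that of λ~′, and let λ~″: ΣC~′ → C~″ be the associated morphism [[λ′, Δ₂′, 0, 0, 0], [μ′, 0, λ′, Δ₂′, μ′δ₂′ + v″Δ₂′ + δ₂″ν′], [Δ₁′, ν′, 0, 0, 0]]. Then λ~₁ is a morphism of S-complexes, and the composite λ~″ ∘ λ~₁: C~ → C~″ is the odd-degree morphism of S-complexes with components λ° = λ′λ + Δ₂′τ₋₁δ₁, μ° = λ′μ + μ′λ + Δ₂′Δ₁, Δ₁° = Δ₁′λ + ν′τ₋₁δ₁, Δ₂° = λ′Δ₂ + Δ₂′τ₀ + δ₂″ν′τ₋₁ + v″Δ₂′τ₋₁ + μ′δ₂′τ₋₁, and ρ° = 0. -/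

import Mathlib

set_option maxHeartbeats 1000000

open Function

universe u

/-- A `ℤ`-graded `R`-module, presented as an `R`-module together with a family of submodules
(the homogeneous pieces). -/
structure GradedMod (R : Type u) [CommRing R] : Type (u + 1) where
  carrier : Type u
  [isAddCommGroup : AddCommGroup carrier]
  [isModule : Module R carrier]
  grading : ℤ → Submodule R carrier

attribute [instance] GradedMod.isAddCommGroup GradedMod.isModule

namespace GradedMod

variable {R : Type u} [CommRing R]

/-- `f` is homogeneous of degree `k` with respect to the gradings. -/
def IsDeg (M N : GradedMod R) (k : ℤ) (f : M.carrier →ₗ[R] N.carrier) : Prop :=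
  ∀ i : ℤ, (M.grading i).map f ≤ N.grading (i + k)

/-- The grading is an internal direct sum decomposition with finitely generated free pieces,
only finitely many of which are nonzero; i.e., the graded module is finitely generated and
free as a graded `R`-module. -/
def IsFGFree (M : GradedMod R) : Prop :=
  DirectSum.IsInternal M.grading ∧ (∀ i : ℤ, Module.Free R ↥(M.grading i)) ∧
    (∀ i : ℤ, Module.Finite R ↥(M.grading i)) ∧ {i : ℤ | M.grading i ≠ ⊥}.Finite

/-- `e` is the sign operator `ε`, acting on the degree `i` homogeneous part by `(-1)^i`. -/
def IsSign (M : GradedMod R) (e : M.carrier →ₗ[R] M.carrier) : Prop :=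
  ∀ i : ℤ, ∀ x ∈ M.grading i, e x = if Even i then x else -x

/-- The shift `M[n]`, with `M[n]_j = M_{n+j}`. -/
def shift (M : GradedMod R) (n : ℤ) : GradedMod R where
  carrier := M.carrier
  grading j := M.grading (n + j)

/-- Direct sum (product) of graded modules. -/
def prodGM (M N : GradedMod R) : GradedMod R where
  carrier := M.carrier × N.carrier
  grading j := (M.grading j).prod (N.grading j)

/-- Tensor product of graded modules, `(M ⊗ N)_k = ⊕_{i+j=k} M_i ⊗ N_j`. -/
noncomputable def tensorGM (M N : GradedMod R) : GradedMod R where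
  carrier := TensorProduct R M.carrier N.carrier
  grading k := ⨆ i : ℤ, Submodule.map₂ (TensorProduct.mk R M.carrier N.carrier)
      (M.grading i) (N.grading (k - i))

/-- Dual of a graded module: a functional has degree `-i` if it kills all `M_j`, `j ≠ i`. -/
def dualGM (M : GradedMod R) : GradedMod R where
  carrier := Module.Dual R M.carrier
  grading j := ⨅ (i : ℤ) (_ : i ≠ -j), (M.grading i).dualAnnihilator

end GradedMod

variable {R : Type u} [CommRing R]

/-- Iterated composition of a linear endomorphism. -/
def lpow {M : Type u} [AddCommGroup M] [Module R M] (f : M →ₗ[R] M) : ℕ → (M →ₗ[R] M)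
  | 0 => LinearMap.id
  | n + 1 => f ∘ₗ lpow f n

section ProdHelpers

variable {A B C D E : Type u} [AddCommGroup A] [Module R A] [AddCommGroup B] [Module R B]
  [AddCommGroup C] [Module R C] [AddCommGroup D] [Module R D] [AddCommGroup E] [Module R E]

def pj₁ : (A × B × C) →ₗ[R] A := LinearMap.fst R A (B × C)
def pj₂ : (A × B × C) →ₗ[R] B := (LinearMap.fst R B C) ∘ₗ (LinearMap.snd R A (B × C))
def pj₃ : (A × B × C) →ₗ[R] C := (LinearMap.snd R B C) ∘ₗ (LinearMap.snd R A (B × C))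

def tri (f : D →ₗ[R] A) (g : D →ₗ[R] B) (h : D →ₗ[R] C) : D →ₗ[R] A × B × C :=
  f.prod (g.prod h)

def qj₁ : (A × B × C × D) →ₗ[R] A := LinearMap.fst R A (B × C × D)
def qj₂ : (A × B × C × D) →ₗ[R] B := (LinearMap.fst R B (C × D)) ∘ₗ (LinearMap.snd R A (B × C × D))
def qj₃ : (A × B × C × D) →ₗ[R] C :=
  (LinearMap.fst R C D) ∘ₗ (LinearMap.snd R B (C × D)) ∘ₗ (LinearMap.snd R A (B × C × D))
def qj₄ : (A × B × C × D) →ₗ[R] D :=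
  (LinearMap.snd R C D) ∘ₗ (LinearMap.snd R B (C × D)) ∘ₗ (LinearMap.snd R A (B × C × D))

def quad (f : E →ₗ[R] A) (g : E →ₗ[R] B) (h : E →ₗ[R] C) (l : E →ₗ[R] D) :
    E →ₗ[R] A × B × C × D := f.prod (g.prod (h.prod l))

end ProdHelpers

/-- The data of an `S`-complex over `R`: graded modules `C` (irreducible summand) and
`𝖱` (reducible summand), together with the component maps of the differential
`d~ = [[d, 0, 0], [v, −d, δ₂], [δ₁, 0, r]]` with respect to `C~ = C ⊕ C[-1] ⊕ 𝖱`. -/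
structure SCData (R : Type u) [CommRing R] : Type (u + 1) where
  Irr : GradedMod R
  Red : GradedMod R
  d : Irr.carrier →ₗ[R] Irr.carrier
  v : Irr.carrier →ₗ[R] Irr.carrier
  δ₁ : Irr.carrier →ₗ[R] Red.carrier
  δ₂ : Red.carrier →ₗ[R] Irr.carrier
  r : Red.carrier →ₗ[R] Red.carrier

namespace SCData

/-- The five relations equivalent to `d~ ∘ d~ = 0`. -/
def Relations (S : SCData R) : Prop :=
  S.d ∘ₗ S.d = 0 ∧
  S.δ₁ ∘ₗ S.d + S.r ∘ₗ S.δ₁ = 0 ∧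
  S.d ∘ₗ S.δ₂ - S.δ₂ ∘ₗ S.r = 0 ∧
  S.d ∘ₗ S.v - S.v ∘ₗ S.d - S.δ₂ ∘ₗ S.δ₁ = 0 ∧
  S.r ∘ₗ S.r = 0

/-- The degree conditions making `d~` a degree `−1` map on `C~ = C ⊕ C[-1] ⊕ 𝖱`. -/
def Degrees (S : SCData R) : Prop :=
  S.Irr.IsDeg S.Irr (-1) S.d ∧ S.Irr.IsDeg S.Irr (-2) S.v ∧
  S.Irr.IsDeg S.Red (-1) S.δ₁ ∧ S.Red.IsDeg S.Irr (-2) S.δ₂ ∧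
  S.Red.IsDeg S.Red (-1) S.r

/-- `S` is an `S`-complex. -/
def IsSComplex (S : SCData R) : Prop :=
  S.Irr.IsFGFree ∧ S.Red.IsFGFree ∧ S.Degrees ∧ S.Relations

/-- `S` is `r`-perfect: the reducible summand is concentrated in even degrees
(which forces `r = 0` and `δ₁ ∘ v^i ∘ δ₂ = 0` for all `i ≥ 0`). -/
def RPerfect (S : SCData R) : Prop :=
  (∀ j : ℤ, Odd j → S.Red.grading j = ⊥) ∧ S.r = 0 ∧
    ∀ i : ℕ, S.δ₁ ∘ₗ lpow S.v i ∘ₗ S.δ₂ = 0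

/-- The total graded module `C~ = C ⊕ C[-1] ⊕ 𝖱`. -/
def Tot (S : SCData R) : GradedMod R where
  carrier := S.Irr.carrier × S.Irr.carrier × S.Red.carrier
  grading j := (S.Irr.grading j).prod ((S.Irr.grading (j - 1)).prod (S.Red.grading j))

/-- The total differential `d~(c, c', ρ) = (d c, v c − d c' + δ₂ ρ, δ₁ c + r ρ)`. -/
def totalDiff (S : SCData R) : S.Tot.carrier →ₗ[R] S.Tot.carrier :=
  tri (S.d ∘ₗ pj₁) (S.v ∘ₗ pj₁ - S.d ∘ₗ pj₂ + S.δ₂ ∘ₗ pj₃) (S.δ₁ ∘ₗ pj₁ + S.r ∘ₗ pj₃)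

/-- The map `χ(c, c', ρ) = (0, c, 0)`. -/
def totalChi (S : SCData R) : S.Tot.carrier →ₗ[R] S.Tot.carrier :=
  tri 0 pj₁ 0

/-- The suspension `ΣC~`: `C_Σ = C[-2] ⊕ 𝖱[-1]`, `𝖱_Σ = 𝖱`, with the differential of
Definition 2.9 of the paper. -/
def susp (S : SCData R) : SCData R where
  Irr := { carrier := S.Irr.carrier × S.Red.carrier
           grading := fun j => (S.Irr.grading (j - 2)).prod (S.Red.grading (j - 1)) }
  Red := S.Red
  d := LinearMap.prod
      (S.d ∘ₗ LinearMap.fst R S.Irr.carrier S.Red.carrier -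
        S.δ₂ ∘ₗ LinearMap.snd R S.Irr.carrier S.Red.carrier)
      (-(S.r ∘ₗ LinearMap.snd R S.Irr.carrier S.Red.carrier))
  v := LinearMap.prod (S.v ∘ₗ LinearMap.fst R S.Irr.carrier S.Red.carrier)
      (S.δ₁ ∘ₗ LinearMap.fst R S.Irr.carrier S.Red.carrier)
  δ₁ := LinearMap.snd R S.Irr.carrier S.Red.carrier
  δ₂ := LinearMap.prod (S.v ∘ₗ S.δ₂) (S.δ₁ ∘ₗ S.δ₂)
  r := S.r

/-- The negative suspension `Σ⁻¹C~`: `C_{Σ⁻¹} = C[2] ⊕ 𝖱[2]`, `𝖱_{Σ⁻¹} = 𝖱`. -/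
def negSusp (S : SCData R) : SCData R where
  Irr := { carrier := S.Irr.carrier × S.Red.carrier
           grading := fun j => (S.Irr.grading (j + 2)).prod (S.Red.grading (j + 2)) }
  Red := S.Red
  d := LinearMap.prod (S.d ∘ₗ LinearMap.fst R S.Irr.carrier S.Red.carrier)
      (S.δ₁ ∘ₗ LinearMap.fst R S.Irr.carrier S.Red.carrier +
        S.r ∘ₗ LinearMap.snd R S.Irr.carrier S.Red.carrier)
  v := LinearMap.prod (S.v ∘ₗ LinearMap.fst R S.Irr.carrier S.Red.carrier +
        S.δ₂ ∘ₗ LinearMap.snd R S.Irr.carrier S.Red.carrier) 0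
  δ₁ := S.δ₁ ∘ₗ S.v ∘ₗ LinearMap.fst R S.Irr.carrier S.Red.carrier +
        S.δ₁ ∘ₗ S.δ₂ ∘ₗ LinearMap.snd R S.Irr.carrier S.Red.carrier
  δ₂ := LinearMap.prod 0 LinearMap.id
  r := S.r

/-- `Σ^n`, the `n`-fold (negative) suspension. -/
def suspPow (S : SCData R) : ℤ → SCData R
  | Int.ofNat n => (fun X : SCData R => X.susp)^[n] S
  | Int.negSucc n => (fun X : SCData R => X.negSusp)^[n + 1] S

/-- The shifted `S`-complex `C~[n]`: gradings shifted, same differential and `χ`-map. -/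
def shiftSC (S : SCData R) (n : ℤ) : SCData R where
  Irr := S.Irr.shift n
  Red := S.Red.shift n
  d := S.d
  v := S.v
  δ₁ := S.δ₁
  δ₂ := S.δ₂
  r := S.r

end SCData

/-- A map of `S`-complexes in block form `[[λ, 0, 0], [μ, λ, Δ₂], [Δ₁, 0, ρ]]`
(equivalently, a `χ`-equivariant map `C~ → C~'`); used both for morphisms and
(with appropriate signs in the total interpretation) for homotopies. -/
structure SMap {R : Type u} [CommRing R] (S T : SCData R) : Type u where
  lam : S.Irr.carrier →ₗ[R] T.Irr.carrier
  mu : S.Irr.carrier →ₗ[R] T.Irr.carrier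
  del1 : S.Irr.carrier →ₗ[R] T.Red.carrier
  del2 : S.Red.carrier →ₗ[R] T.Irr.carrier
  rho : S.Red.carrier →ₗ[R] T.Red.carrier

namespace SMap

variable {S T U : SCData R}

/-- The component relations equivalent to `d~' λ~ = λ~ d~`. -/
def IsMor (f : SMap S T) : Prop :=
  T.d ∘ₗ f.lam - f.lam ∘ₗ S.d = 0 ∧
  f.del1 ∘ₗ S.d + f.rho ∘ₗ S.δ₁ - T.δ₁ ∘ₗ f.lam - T.r ∘ₗ f.del1 = 0 ∧
  T.d ∘ₗ f.del2 - T.δ₂ ∘ₗ f.rho + f.lam ∘ₗ S.δ₂ + f.del2 ∘ₗ S.r = 0 ∧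
  f.mu ∘ₗ S.d + T.d ∘ₗ f.mu + f.lam ∘ₗ S.v - T.v ∘ₗ f.lam + f.del2 ∘ₗ S.δ₁ - T.δ₂ ∘ₗ f.del1 = 0 ∧
  f.rho ∘ₗ S.r - T.r ∘ₗ f.rho = 0

/-- The components have the degrees of a degree `k` map of `S`-complexes. -/
def DegreesAt (f : SMap S T) (k : ℤ) : Prop :=
  S.Irr.IsDeg T.Irr k f.lam ∧ S.Irr.IsDeg T.Irr (k - 1) f.mu ∧
  S.Irr.IsDeg T.Red k f.del1 ∧ S.Red.IsDeg T.Irr (k - 1) f.del2 ∧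
  S.Red.IsDeg T.Red k f.rho

/-- Composition of morphisms of `S`-complexes, componentwise. -/
def comp (g : SMap T U) (f : SMap S T) : SMap S U where
  lam := g.lam ∘ₗ f.lam
  mu := g.lam ∘ₗ f.mu + g.mu ∘ₗ f.lam + g.del2 ∘ₗ f.del1
  del1 := g.del1 ∘ₗ f.lam + g.rho ∘ₗ f.del1
  del2 := g.lam ∘ₗ f.del2 + g.del2 ∘ₗ f.rho
  rho := g.rho ∘ₗ f.rho

/-- `K` is an `S`-chain homotopy from `f` to `g`, i.e. `d~' K~ + K~ d~ = λ~ - λ~'` where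
`K~ = [[K, 0, 0], [L, -K, M₂], [M₁, 0, J]]`, in component form. -/
def IsHtpyFrom (K f g : SMap S T) : Prop :=
  T.d ∘ₗ K.lam + K.lam ∘ₗ S.d - f.lam + g.lam = 0 ∧
  T.δ₁ ∘ₗ K.lam + T.r ∘ₗ K.del1 + K.del1 ∘ₗ S.d + K.rho ∘ₗ S.δ₁ - f.del1 + g.del1 = 0 ∧
  -(T.d ∘ₗ K.del2) + T.δ₂ ∘ₗ K.rho - K.lam ∘ₗ S.δ₂ + K.del2 ∘ₗ S.r - f.del2 + g.del2 = 0 ∧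
  T.v ∘ₗ K.lam - T.d ∘ₗ K.mu + T.δ₂ ∘ₗ K.del1 + K.mu ∘ₗ S.d - K.lam ∘ₗ S.v + K.del2 ∘ₗ S.δ₁
    - f.mu + g.mu = 0 ∧
  T.r ∘ₗ K.rho + K.rho ∘ₗ S.r - f.rho + g.rho = 0

end SMap

/-- The identity morphism. -/
def idMap (S : SCData R) : SMap S S where
  lam := LinearMap.id
  mu := 0
  del1 := 0
  del2 := 0
  rho := LinearMap.id

/-- The total map `C~ → C~'` of a morphism in block form. -/
def morTotal {S T : SCData R} (f : SMap S T) : S.Tot.carrier →ₗ[R] T.Tot.carrier :=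
  tri (f.lam ∘ₗ pj₁) (f.mu ∘ₗ pj₁ + f.lam ∘ₗ pj₂ + f.del2 ∘ₗ pj₃) (f.del1 ∘ₗ pj₁ + f.rho ∘ₗ pj₃)

/-- The total map `C~ → C~'` of a homotopy in block form. -/
def htpTotal {S T : SCData R} (K : SMap S T) : S.Tot.carrier →ₗ[R] T.Tot.carrier :=
  tri (K.lam ∘ₗ pj₁) (K.mu ∘ₗ pj₁ - K.lam ∘ₗ pj₂ + K.del2 ∘ₗ pj₃) (K.del1 ∘ₗ pj₁ + K.rho ∘ₗ pj₃)

/-- `S`-chain homotopy equivalence of `S`-complexes. -/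
def SHomotopyEquiv (S T : SCData R) : Prop :=
  ∃ (f : SMap S T) (g : SMap T S) (H₁ : SMap S S) (H₂ : SMap T T),
    f.IsMor ∧ f.DegreesAt 0 ∧ g.IsMor ∧ g.DegreesAt 0 ∧
    H₁.DegreesAt 1 ∧ SMap.IsHtpyFrom H₁ (g.comp f) (idMap S) ∧
    H₂.DegreesAt 1 ∧ SMap.IsHtpyFrom H₂ (f.comp g) (idMap T)

/-- Isomorphism of `S`-complexes: a (degree `0`) morphism with a two-sided inverse morphism. -/
def SIso (S T : SCData R) : Prop :=
  ∃ (f : SMap S T) (g : SMap T S), f.IsMor ∧ f.DegreesAt 0 ∧ g.IsMor ∧ g.DegreesAt 0 ∧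
    g.comp f = idMap S ∧ f.comp g = idMap T

/-- The suspension `Σλ~` of a morphism `λ~`, in block form. -/
def suspMap {S T : SCData R} (f : SMap S T) : SMap S.susp T.susp where
  lam := LinearMap.prod
      (f.lam ∘ₗ LinearMap.fst R S.Irr.carrier S.Red.carrier +
        f.del2 ∘ₗ LinearMap.snd R S.Irr.carrier S.Red.carrier)
      (f.rho ∘ₗ LinearMap.snd R S.Irr.carrier S.Red.carrier)
  mu := LinearMap.prod (f.mu ∘ₗ LinearMap.fst R S.Irr.carrier S.Red.carrier)
      (f.del1 ∘ₗ LinearMap.fst R S.Irr.carrier S.Red.carrier)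
  del1 := 0
  del2 := LinearMap.prod (f.mu ∘ₗ S.δ₂ + T.v ∘ₗ f.del2) (f.del1 ∘ₗ S.δ₂ + T.δ₁ ∘ₗ f.del2)
  rho := f.rho

/-- The suspension `ΣK~` of a homotopy `K~`, in block form. -/
def suspHtpy {S T : SCData R} (K : SMap S T) : SMap S.susp T.susp where
  lam := LinearMap.prod
      (K.lam ∘ₗ LinearMap.fst R S.Irr.carrier S.Red.carrier -
        K.del2 ∘ₗ LinearMap.snd R S.Irr.carrier S.Red.carrier)
      (-(K.rho ∘ₗ LinearMap.snd R S.Irr.carrier S.Red.carrier))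
  mu := LinearMap.prod (K.mu ∘ₗ LinearMap.fst R S.Irr.carrier S.Red.carrier)
      (K.del1 ∘ₗ LinearMap.fst R S.Irr.carrier S.Red.carrier)
  del1 := 0
  del2 := LinearMap.prod (T.v ∘ₗ K.del2 + K.mu ∘ₗ S.δ₂) (T.δ₁ ∘ₗ K.del2 + K.del1 ∘ₗ S.δ₂)
  rho := K.rho

/-- The sequence `τ_0 = ρ`, `τ_{i+1} = δ₁'v'^iΔ₂ + Δ₁v^iδ₂ + Σ_{j<i} δ₁'v'^j μ v^{i−1−j} δ₂`
attached to an (even degree) morphism between `r`-perfect `S`-complexes. -/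
def tauSMap {S T : SCData R} (f : SMap S T) : ℕ → (S.Red.carrier →ₗ[R] T.Red.carrier)
  | 0 => f.rho
  | i + 1 =>
      T.δ₁ ∘ₗ lpow T.v i ∘ₗ f.del2 + f.del1 ∘ₗ lpow S.v i ∘ₗ S.δ₂ +
        ∑ j ∈ Finset.range i, T.δ₁ ∘ₗ lpow T.v j ∘ₗ f.mu ∘ₗ lpow S.v (i - 1 - j) ∘ₗ S.δ₂

/-- Height `n` (for `n ≥ 0`): `τ_j = 0` for `0 ≤ j < n`. -/
def SMap.HasHeight {S T : SCData R} (f : SMap S T) (n : ℕ) : Prop :=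
  ∀ j : ℕ, j < n → tauSMap f j = 0

/-- Strong height `n`: height `n` and `τ_n` an isomorphism. -/
def SMap.StrongHeight {S T : SCData R} (f : SMap S T) (n : ℕ) : Prop :=
  f.HasHeight n ∧ Function.Bijective ⇑(tauSMap f n)

/-- The explicit model of the `n`-fold suspension `Σ^n C~` of an `r`-perfect `S`-complex:
`C_{Σ^n} = C[-2n] ⊕ ⊕_{i=0}^{n-1} 𝖱[-2i-1]` (the `m`-th factor of `Fin n → 𝖱` being
`𝖱[-2(n-1-m)-1]`), `𝖱_{Σ^n} = 𝖱`, with the components of the differential as in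
Subsection 2.4 of the paper. -/
def SCData.suspN (S : SCData R) (n : ℕ) : SCData R where
  Irr := { carrier := S.Irr.carrier × (Fin n → S.Red.carrier)
           grading := fun j => (S.Irr.grading (j - 2 * (n : ℤ))).prod
             (Submodule.pi Set.univ fun m : Fin n =>
               S.Red.grading (j - 2 * (((n - 1 - (m : ℕ) : ℕ)) : ℤ) - 1)) }
  Red := S.Red
  d := LinearMap.prod
      (S.d ∘ₗ LinearMap.fst R S.Irr.carrier (Fin n → S.Red.carrier) -
        ∑ m : Fin n, lpow S.v (m : ℕ) ∘ₗ S.δ₂ ∘ₗ LinearMap.proj m ∘ₗ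
          LinearMap.snd R S.Irr.carrier (Fin n → S.Red.carrier)) 0
  v := LinearMap.prod (S.v ∘ₗ LinearMap.fst R S.Irr.carrier (Fin n → S.Red.carrier))
      (LinearMap.pi fun m : Fin n =>
        if (m : ℕ) = 0 then S.δ₁ ∘ₗ LinearMap.fst R S.Irr.carrier (Fin n → S.Red.carrier)
        else LinearMap.proj (⟨(m : ℕ) - 1, lt_of_le_of_lt (Nat.sub_le _ _) m.isLt⟩ : Fin n) ∘ₗ
          LinearMap.snd R S.Irr.carrier (Fin n → S.Red.carrier))
  δ₁ := if h : 0 < n then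
      LinearMap.proj (⟨n - 1, Nat.sub_lt h Nat.one_pos⟩ : Fin n) ∘ₗ
        LinearMap.snd R S.Irr.carrier (Fin n → S.Red.carrier)
    else 0
  δ₂ := LinearMap.prod (lpow S.v n ∘ₗ S.δ₂) 0
  r := 0

/-- The natural morphism `ι~_n : C~ → Σ^n C~`, with `λ`-component `c ↦ (c, 0, …, 0)` and
`Δ₂`-component `θ ↦ (0, θ, 0, …, 0)`. -/
def iotaN (S : SCData R) (n : ℕ) : SMap S (S.suspN n) where
  lam := LinearMap.prod LinearMap.id 0
  mu := 0
  del1 := 0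
  del2 := LinearMap.prod 0 (LinearMap.pi fun m : Fin n => if (m : ℕ) = 0 then LinearMap.id else 0)
  rho := 0

/-- The data of a generalized height morphism between `r`-perfect `S`-complexes:
the four maps `λ, μ, Δ₁, Δ₂` and the sequence `τ_i` for `i ∈ ℤ`. -/
structure HMor {R : Type u} [CommRing R] (S T : SCData R) : Type u where
  lam : S.Irr.carrier →ₗ[R] T.Irr.carrier
  mu : S.Irr.carrier →ₗ[R] T.Irr.carrier
  del1 : S.Irr.carrier →ₗ[R] T.Red.carrier
  del2 : S.Red.carrier →ₗ[R] T.Irr.carrier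
  tau : ℤ → (S.Red.carrier →ₗ[R] T.Red.carrier)

/-- `f` is a height `n` morphism of (even) degree `k` between `r`-perfect `S`-complexes. -/
def HMor.IsHeightMor {S T : SCData R} (f : HMor S T) (n : ℤ) (k : ℤ) : Prop :=
  Even k ∧
  S.Irr.IsDeg T.Irr k f.lam ∧ S.Irr.IsDeg T.Irr (k - 1) f.mu ∧
  S.Irr.IsDeg T.Red k f.del1 ∧ S.Red.IsDeg T.Irr (k - 1) f.del2 ∧
  (∀ i : ℤ, S.Red.IsDeg T.Red (k - 2 * i) (f.tau i)) ∧
  (∀ i : ℤ, i < n → f.tau i = 0) ∧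
  (∀ i : ℕ, f.tau ((i : ℤ) + 1) =
      T.δ₁ ∘ₗ lpow T.v i ∘ₗ f.del2 + f.del1 ∘ₗ lpow S.v i ∘ₗ S.δ₂ +
        ∑ j ∈ Finset.range i, T.δ₁ ∘ₗ lpow T.v j ∘ₗ f.mu ∘ₗ lpow S.v (i - 1 - j) ∘ₗ S.δ₂) ∧
  (T.d ∘ₗ f.lam - f.lam ∘ₗ S.d -
      ∑ᶠ i : ℕ, ∑ j ∈ Finset.range (i + 1),
        lpow T.v j ∘ₗ T.δ₂ ∘ₗ f.tau (-((i : ℤ) + 1)) ∘ₗ S.δ₁ ∘ₗ lpow S.v (i - j) = 0) ∧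
  (-(T.δ₁ ∘ₗ f.lam) + f.del1 ∘ₗ S.d + ∑ᶠ i : ℕ, f.tau (-(i : ℤ)) ∘ₗ S.δ₁ ∘ₗ lpow S.v i = 0) ∧
  (f.lam ∘ₗ S.δ₂ + T.d ∘ₗ f.del2 - ∑ᶠ i : ℕ, lpow T.v i ∘ₗ T.δ₂ ∘ₗ f.tau (-(i : ℤ)) = 0) ∧
  (f.mu ∘ₗ S.d + T.d ∘ₗ f.mu + f.lam ∘ₗ S.v - T.v ∘ₗ f.lam + f.del2 ∘ₗ S.δ₁ - T.δ₂ ∘ₗ f.del1 = 0)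

/-- Composition of generalized height morphisms (Definition 2.23 of the paper). -/
noncomputable def HMor.compH {S T U : SCData R} (g : HMor T U) (f : HMor S T) : HMor S U where
  lam := g.lam ∘ₗ f.lam
    + (∑ᶠ i : ℕ, ∑ j ∈ Finset.range (i + 1),
        lpow U.v j ∘ₗ U.δ₂ ∘ₗ g.tau (-((i : ℤ) + 1)) ∘ₗ f.del1 ∘ₗ lpow S.v (i - j))
    + (∑ᶠ i : ℕ, ∑ j ∈ Finset.range (i + 1),
        lpow U.v j ∘ₗ g.del2 ∘ₗ f.tau (-((i : ℤ) + 1)) ∘ₗ S.δ₁ ∘ₗ lpow S.v (i - j))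
    + (∑ᶠ i : ℕ, ∑ j ∈ Finset.range (i + 1), ∑ l ∈ Finset.range (i - j + 1),
        lpow U.v j ∘ₗ U.δ₂ ∘ₗ g.tau (-((i : ℤ) + 2)) ∘ₗ T.δ₁ ∘ₗ lpow T.v l ∘ₗ f.mu ∘ₗ
          lpow S.v (i - j - l))
    + (∑ᶠ i : ℕ, ∑ j ∈ Finset.range (i + 1), ∑ l ∈ Finset.range (i - j + 1),
        lpow U.v j ∘ₗ g.mu ∘ₗ lpow T.v l ∘ₗ T.δ₂ ∘ₗ f.tau (-((i : ℤ) + 2)) ∘ₗ S.δ₁ ∘ₗ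
          lpow S.v (i - j - l))
  mu := g.lam ∘ₗ f.mu + g.mu ∘ₗ f.lam + g.del2 ∘ₗ f.del1
  del1 := g.del1 ∘ₗ f.lam + (∑ᶠ i : ℕ, g.tau (-(i : ℤ)) ∘ₗ f.del1 ∘ₗ lpow S.v i)
    + (∑ᶠ i : ℕ, ∑ j ∈ Finset.range (i + 1),
        g.tau (-((i : ℤ) + 1)) ∘ₗ T.δ₁ ∘ₗ lpow T.v j ∘ₗ f.mu ∘ₗ lpow S.v (i - j))
  del2 := g.lam ∘ₗ f.del2 + (∑ᶠ i : ℕ, lpow U.v i ∘ₗ g.del2 ∘ₗ f.tau (-(i : ℤ)))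
    + (∑ᶠ i : ℕ, ∑ j ∈ Finset.range (i + 1),
        lpow U.v j ∘ₗ g.mu ∘ₗ lpow T.v (i - j) ∘ₗ T.δ₂ ∘ₗ f.tau (-((i : ℤ) + 1)))
  tau := fun i => ∑ᶠ l : ℤ, g.tau (i - l) ∘ₗ f.tau l

/-- The strong height `−n` morphism `κ~_n : Σ^n C~ → C~`. -/
def kappaN (T : SCData R) (n : ℕ) : HMor (T.suspN n) T where
  lam := LinearMap.fst R T.Irr.carrier (Fin n → T.Red.carrier)
  mu := 0
  del1 := 0
  del2 := 0
  tau := fun i => if i = -(n : ℤ) then LinearMap.id else 0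

/-- An (even degree) morphism of `S`-complexes, regarded as a generalized height morphism. -/
def SMap.toHMor {S T : SCData R} (f : SMap S T) : HMor S T where
  lam := f.lam
  mu := f.mu
  del1 := f.del1
  del2 := f.del2
  tau := fun i => if 0 ≤ i then tauSMap f i.toNat else 0

/-- The height `0` morphism `λ~' : C~ → Σ^n C~'` associated to a height `−n` morphism
(Proposition 2.25 of the paper). -/
def heightNegToSusp {S T : SCData R} (f : HMor S T) (n : ℕ) : SMap S (T.suspN n) where
  lam := LinearMap.prod f.lam
    (LinearMap.pi fun m : Fin n =>
      ∑ i ∈ Finset.Icc ((m : ℕ) + 1) n, f.tau (-(i : ℤ)) ∘ₗ S.δ₁ ∘ₗ lpow S.v (i - 1 - (m : ℕ)))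
  mu := LinearMap.prod f.mu (LinearMap.pi fun m : Fin n => if (m : ℕ) = 0 then f.del1 else 0)
  del1 := 0
  del2 := LinearMap.prod f.del2 (LinearMap.pi fun m : Fin n => f.tau (-((m : ℕ) : ℤ)))
  rho := f.tau (-(n : ℤ))

/-- The morphism `ι~₁ : C~ → ΣC~`. -/
def iotaOne (S : SCData R) : SMap S S.susp where
  lam := LinearMap.prod LinearMap.id 0
  mu := 0
  del1 := 0
  del2 := LinearMap.prod 0 LinearMap.id
  rho := 0

/-- The morphism `λ~'' : ΣC~' → C~''` associated to an odd degree morphism `λ~'` together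
with the map `ν' : 𝖱' → 𝖱''` (Subsection 2.6 of the paper). -/
def lambdaSecond {S T : SCData R} (f : SMap S T) (nu : S.Red.carrier →ₗ[R] T.Red.carrier) :
    SMap S.susp T where
  lam := f.lam ∘ₗ LinearMap.fst R S.Irr.carrier S.Red.carrier +
    f.del2 ∘ₗ LinearMap.snd R S.Irr.carrier S.Red.carrier
  mu := f.mu ∘ₗ LinearMap.fst R S.Irr.carrier S.Red.carrier
  del1 := f.del1 ∘ₗ LinearMap.fst R S.Irr.carrier S.Red.carrier +
    nu ∘ₗ LinearMap.snd R S.Irr.carrier S.Red.carrier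
  del2 := f.mu ∘ₗ S.δ₂ + T.v ∘ₗ f.del2 + T.δ₂ ∘ₗ nu
  rho := 0

/-- The morphism `λ~₁ : C~ → ΣC~'` associated to height `−1` morphism data
`(λ, μ, Δ₁, Δ₂, τ₀, τ₋₁)`, in block form
`[[λ, 0, 0], [τ₋₁δ₁, 0, 0], [μ, λ, Δ₂], [Δ₁, τ₋₁δ₁, τ₀], [0, 0, τ₋₁]]`. -/
def hNegOneSusp {S T : SCData R} (lam0 mu0 : S.Irr.carrier →ₗ[R] T.Irr.carrier)
    (del10 : S.Irr.carrier →ₗ[R] T.Red.carrier) (del20 : S.Red.carrier →ₗ[R] T.Irr.carrier)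
    (tau0 taum1 : S.Red.carrier →ₗ[R] T.Red.carrier) : SMap S T.susp where
  lam := LinearMap.prod lam0 (taum1 ∘ₗ S.δ₁)
  mu := LinearMap.prod mu0 del10
  del1 := 0
  del2 := LinearMap.prod del20 tau0
  rho := taum1

/-- The mapping cone of a degree `k` morphism `λ~ : C~ → C~'`, as an `S`-complex;
its underlying graded module is `C~[-1-k] ⊕ C~'`. -/
def coneSC {S T : SCData R} (f : SMap S T) (k : ℤ) : SCData R where
  Irr := { carrier := S.Irr.carrier × T.Irr.carrier
           grading := fun j => (S.Irr.grading (j - 1 - k)).prod (T.Irr.grading j) }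
  Red := { carrier := S.Red.carrier × T.Red.carrier
           grading := fun j => (S.Red.grading (j - 1 - k)).prod (T.Red.grading j) }
  d := LinearMap.prod (-(S.d ∘ₗ LinearMap.fst R S.Irr.carrier T.Irr.carrier))
      (f.lam ∘ₗ LinearMap.fst R S.Irr.carrier T.Irr.carrier +
        T.d ∘ₗ LinearMap.snd R S.Irr.carrier T.Irr.carrier)
  v := LinearMap.prod (S.v ∘ₗ LinearMap.fst R S.Irr.carrier T.Irr.carrier)
      (f.mu ∘ₗ LinearMap.fst R S.Irr.carrier T.Irr.carrier +
        T.v ∘ₗ LinearMap.snd R S.Irr.carrier T.Irr.carrier)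
  δ₁ := LinearMap.prod (-(S.δ₁ ∘ₗ LinearMap.fst R S.Irr.carrier T.Irr.carrier))
      (f.del1 ∘ₗ LinearMap.fst R S.Irr.carrier T.Irr.carrier +
        T.δ₁ ∘ₗ LinearMap.snd R S.Irr.carrier T.Irr.carrier)
  δ₂ := LinearMap.prod (S.δ₂ ∘ₗ LinearMap.fst R S.Red.carrier T.Red.carrier)
      (f.del2 ∘ₗ LinearMap.fst R S.Red.carrier T.Red.carrier +
        T.δ₂ ∘ₗ LinearMap.snd R S.Red.carrier T.Red.carrier)
  r := LinearMap.prod (-(S.r ∘ₗ LinearMap.fst R S.Red.carrier T.Red.carrier))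
      (f.rho ∘ₗ LinearMap.fst R S.Red.carrier T.Red.carrier +
        T.r ∘ₗ LinearMap.snd R S.Red.carrier T.Red.carrier)

/-- Direct sum of `S`-complexes. -/
def sumSC (S T : SCData R) : SCData R where
  Irr := S.Irr.prodGM T.Irr
  Red := S.Red.prodGM T.Red
  d := S.d.prodMap T.d
  v := S.v.prodMap T.v
  δ₁ := S.δ₁.prodMap T.δ₁
  δ₂ := S.δ₂.prodMap T.δ₂
  r := S.r.prodMap T.r

/-- The dual `S`-complex `C~†`, defined using sign operators on the dual graded modules:
`m†(f) = −ε(f) f ∘ m`, with the roles of `δ₁` and `δ₂` interchanged. -/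
def dualSC (S : SCData R)
    (eCd : Module.Dual R S.Irr.carrier →ₗ[R] Module.Dual R S.Irr.carrier)
    (eRd : Module.Dual R S.Red.carrier →ₗ[R] Module.Dual R S.Red.carrier) : SCData R where
  Irr := S.Irr.dualGM
  Red := S.Red.dualGM
  d := -(S.d.dualMap ∘ₗ eCd)
  v := -(S.v.dualMap ∘ₗ eCd)
  δ₁ := -(S.δ₂.dualMap ∘ₗ eCd)
  δ₂ := -(S.δ₁.dualMap ∘ₗ eRd)
  r := -(S.r.dualMap ∘ₗ eRd)

/-- The rank-one graded module `R`, concentrated in degree `n`. -/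
def unitGM (R : Type u) [CommRing R] (n : ℤ) : GradedMod R where
  carrier := R
  grading j := if j = n then ⊤ else ⊥

/-- The `S`-complex `O~(1)`: `C = R` in degree `1`, `𝖱 = R` in degree `0`, `δ₁ = id`. -/
def O1 (R : Type u) [CommRing R] : SCData R where
  Irr := unitGM R 1
  Red := unitGM R 0
  d := 0
  v := 0
  δ₁ := LinearMap.id
  δ₂ := 0
  r := 0

/-- The `S`-complex `O~(-1)`: `C = R` in degree `-2`, `𝖱 = R` in degree `0`, `δ₂ = id`. -/
def Om1 (R : Type u) [CommRing R] : SCData R where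
  Irr := unitGM R (-2)
  Red := unitGM R 0
  d := 0
  v := 0
  δ₁ := 0
  δ₂ := LinearMap.id
  r := 0

/-- The `S`-complex `O~(0)`: `C = 0`, `𝖱 = R` in degree `0`, zero differential. -/
def O0 (R : Type u) [CommRing R] : SCData R where
  Irr := { carrier := ↥(⊥ : Submodule R R), grading := fun _ => ⊥ }
  Red := unitGM R 0
  d := 0
  v := 0
  δ₁ := 0
  δ₂ := 0
  r := 0

/-- The `S`-complex representation of the tensor product `C~ ⊗ C~'` of `S`-complexes
(Subsection 2.2 of the paper), where `eC`, `eR` are the sign operators of the first factor: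
`C^⊗ = (C⊗C') ⊕ (C⊗C')[-1] ⊕ (C⊗𝖱') ⊕ (𝖱⊗C')` and `𝖱^⊗ = 𝖱⊗𝖱'`. -/
noncomputable def tensorRep (S T : SCData R)
    (eC : S.Irr.carrier →ₗ[R] S.Irr.carrier) (eR : S.Red.carrier →ₗ[R] S.Red.carrier) :
    SCData R where
  Irr := (S.Irr.tensorGM T.Irr).prodGM (((S.Irr.tensorGM T.Irr).shift (-1)).prodGM
      ((S.Irr.tensorGM T.Red).prodGM (S.Red.tensorGM T.Irr)))
  Red := S.Red.tensorGM T.Red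
  d := quad
      (TensorProduct.map S.d LinearMap.id ∘ₗ qj₁ + TensorProduct.map eC T.d ∘ₗ qj₁)
      (TensorProduct.map (-(eC ∘ₗ S.v)) LinearMap.id ∘ₗ qj₁ + TensorProduct.map eC T.v ∘ₗ qj₁
        + TensorProduct.map S.d LinearMap.id ∘ₗ qj₂ - TensorProduct.map eC T.d ∘ₗ qj₂
        + TensorProduct.map eC T.δ₂ ∘ₗ qj₃
        + TensorProduct.map (-(eC ∘ₗ S.δ₂)) LinearMap.id ∘ₗ qj₄)
      (TensorProduct.map eC T.δ₁ ∘ₗ qj₁ + TensorProduct.map S.d LinearMap.id ∘ₗ qj₃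
        + TensorProduct.map eC T.r ∘ₗ qj₃)
      (TensorProduct.map S.δ₁ LinearMap.id ∘ₗ qj₁ + TensorProduct.map eR T.d ∘ₗ qj₄
        + TensorProduct.map S.r LinearMap.id ∘ₗ qj₄)
  v := quad
      (TensorProduct.map S.v LinearMap.id ∘ₗ qj₁ + TensorProduct.map S.δ₂ LinearMap.id ∘ₗ qj₄)
      (TensorProduct.map S.v LinearMap.id ∘ₗ qj₂)
      (TensorProduct.map S.v LinearMap.id ∘ₗ qj₃)
      (TensorProduct.map (eR ∘ₗ S.δ₁) LinearMap.id ∘ₗ qj₂ + TensorProduct.map LinearMap.id T.v ∘ₗ qj₄)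
  δ₁ := TensorProduct.map S.δ₁ LinearMap.id ∘ₗ qj₃ + TensorProduct.map eR T.δ₁ ∘ₗ qj₄
  δ₂ := quad 0 0 (TensorProduct.map S.δ₂ LinearMap.id) (TensorProduct.map LinearMap.id T.δ₂)
  r := TensorProduct.map S.r LinearMap.id + TensorProduct.map eR T.r

/-- Homology of an endomorphism (thought of as a differential): `ker D / im D`. -/
abbrev homologyOf {M : Type u} [AddCommGroup M] [Module R M] (D : M →ₗ[R] M) : Type u :=
  ↥(LinearMap.ker D) ⧸
    Submodule.comap (LinearMap.ker D).subtype (LinearMap.range D)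

/-- The map induced on homology by a chain map. -/
def inducedMap {M N : Type u} [AddCommGroup M] [Module R M] [AddCommGroup N] [Module R N]
    (DM : M →ₗ[R] M) (DN : N →ₗ[R] N) (f : M →ₗ[R] N) (h : DN ∘ₗ f = f ∘ₗ DM) :
    homologyOf DM →ₗ[R] homologyOf DN :=
  Submodule.mapQ _ _
    (f.restrict (p := LinearMap.ker DM) (q := LinearMap.ker DN) (fun x hx => by
      have h1 : DN (f x) = f (DM x) := by
        have h2 := LinearMap.congr_fun h x
        simpa using h2
      have hx0 : DM x = 0 := LinearMap.mem_ker.mp hx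
      simp [LinearMap.mem_ker, h1, hx0]))
    (by
      intro x hx
      simp only [Submodule.mem_comap] at hx ⊢
      obtain ⟨y, hy⟩ := hx
      refine ⟨f y, ?_⟩
      have h1 : DN (f y) = f (DM y) := by
        have h2 := LinearMap.congr_fun h y
        simpa using h2
      simp only [Submodule.coe_subtype] at hy ⊢
      rw [LinearMap.restrict_apply]
      rw [h1, hy])

/-- The degree `j` homology of a graded module with a (degree `-1`) differential. -/
abbrev gradedHomology (M : GradedMod R) (D : M.carrier →ₗ[R] M.carrier) (j : ℤ) : Type u :=
  ↥(M.grading j ⊓ LinearMap.ker D) ⧸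
    Submodule.comap (M.grading j ⊓ LinearMap.ker D).subtype ((M.grading (j + 1)).map D)

/-- The Euler characteristic `Σ_j (-1)^j rk_R M_j` of a graded module. -/
noncomputable def eulerChar (M : GradedMod R) : ℤ :=
  ∑ᶠ j : ℤ, (if Even j then (1 : ℤ) else -1) * (Module.finrank R ↥(M.grading j) : ℤ)

/-- The small equivariant complex `Ĉ = C[-1] ⊕ 𝖱[x]`, with `𝖱[x]` modelled as `ℕ →₀ 𝖱`. -/
abbrev hatC (S : SCData R) : Type u := S.Irr.carrier × (ℕ →₀ S.Red.carrier)

/-- The differential `𝔡̂(α, θxⁱ) = (dα − vⁱδ₂θ, 0)`. -/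
noncomputable def hatD (S : SCData R) : hatC S →ₗ[R] hatC S :=
  LinearMap.prod
    (S.d ∘ₗ LinearMap.fst R S.Irr.carrier (ℕ →₀ S.Red.carrier) -
      (Finsupp.lsum ℕ fun i : ℕ => lpow S.v i ∘ₗ S.δ₂) ∘ₗ
        LinearMap.snd R S.Irr.carrier (ℕ →₀ S.Red.carrier))
    0

/-- The `x`-action `x·(α, θxⁱ) = (vα, δ₁α + θx^{i+1})` on `Ĉ`. -/
noncomputable def hatX (S : SCData R) : hatC S →ₗ[R] hatC S :=
  LinearMap.prod (S.v ∘ₗ LinearMap.fst R S.Irr.carrier (ℕ →₀ S.Red.carrier))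
    (Finsupp.lsingle 0 ∘ₗ S.δ₁ ∘ₗ LinearMap.fst R S.Irr.carrier (ℕ →₀ S.Red.carrier) +
      Finsupp.lmapDomain S.Red.carrier R (fun i => i + 1) ∘ₗ
        LinearMap.snd R S.Irr.carrier (ℕ →₀ S.Red.carrier))

/-- The small equivariant complex `Č = C ⊕ 𝖱[[x⁻¹,x]/𝖱[x]`, the tail modelled as `ℕ → 𝖱`
(the `m`-th coordinate is the coefficient of `x^{-m-1}`). -/
abbrev checkC (S : SCData R) : Type u := S.Irr.carrier × (ℕ → S.Red.carrier)

/-- The differential `𝔡̌(α, θxⁱ) = (dα, Σ_{j≤-1} δ₁v^{−j−1}(α)xʲ)`. -/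
noncomputable def checkD (S : SCData R) : checkC S →ₗ[R] checkC S :=
  LinearMap.prod (S.d ∘ₗ LinearMap.fst R S.Irr.carrier (ℕ → S.Red.carrier))
    (LinearMap.pi fun m : ℕ =>
      S.δ₁ ∘ₗ lpow S.v m ∘ₗ LinearMap.fst R S.Irr.carrier (ℕ → S.Red.carrier))

/-- The `x`-action on `Č`. -/
noncomputable def checkX (S : SCData R) : checkC S →ₗ[R] checkC S :=
  LinearMap.prod
    (S.v ∘ₗ LinearMap.fst R S.Irr.carrier (ℕ → S.Red.carrier) +
      S.δ₂ ∘ₗ LinearMap.proj 0 ∘ₗ LinearMap.snd R S.Irr.carrier (ℕ → S.Red.carrier))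
    (LinearMap.pi fun m : ℕ =>
      LinearMap.proj (m + 1) ∘ₗ LinearMap.snd R S.Irr.carrier (ℕ → S.Red.carrier))

/-- The module `𝖱[[x⁻¹,x]` of Laurent series with finitely many positive powers, modelled
as (polynomial part, tail): `(ℕ →₀ 𝖱) × (ℕ → 𝖱)`. -/
abbrev barC (S : SCData R) : Type u := (ℕ →₀ S.Red.carrier) × (ℕ → S.Red.carrier)

/-- Multiplication by `x` on `𝖱[[x⁻¹,x]`. -/
noncomputable def barX (S : SCData R) : barC S →ₗ[R] barC S :=
  LinearMap.prod
    (Finsupp.lsingle 0 ∘ₗ LinearMap.proj 0 ∘ₗ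
        LinearMap.snd R (ℕ →₀ S.Red.carrier) (ℕ → S.Red.carrier) +
      Finsupp.lmapDomain S.Red.carrier R (fun i => i + 1) ∘ₗ
        LinearMap.fst R (ℕ →₀ S.Red.carrier) (ℕ → S.Red.carrier))
    (LinearMap.pi fun m : ℕ =>
      LinearMap.proj (m + 1) ∘ₗ LinearMap.snd R (ℕ →₀ S.Red.carrier) (ℕ → S.Red.carrier))

/-- The chain map `𝔦 : Ĉ → 𝖱[[x⁻¹,x]`, `(α, θ) ↦ Σ_{i≤-1} δ₁v^{−i−1}(α)xⁱ + θ`. -/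
noncomputable def mapI (S : SCData R) : hatC S →ₗ[R] barC S :=
  LinearMap.prod (LinearMap.snd R S.Irr.carrier (ℕ →₀ S.Red.carrier))
    (LinearMap.pi fun m : ℕ =>
      S.δ₁ ∘ₗ lpow S.v m ∘ₗ LinearMap.fst R S.Irr.carrier (ℕ →₀ S.Red.carrier))

/-- The chain map `𝔧 : Č → Ĉ`, `(α, ·) ↦ (−α, 0)`. -/
noncomputable def mapJ (S : SCData R) : checkC S →ₗ[R] hatC S :=
  LinearMap.prod (-(LinearMap.fst R S.Irr.carrier (ℕ → S.Red.carrier))) 0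

/-- The chain map `𝔭 : 𝖱[[x⁻¹,x] → Č`, `Σθᵢxⁱ ↦ (Σ_{i≥0} vⁱδ₂θᵢ, Σ_{i≤-1} θᵢxⁱ)`. -/
noncomputable def mapP (S : SCData R) : barC S →ₗ[R] checkC S :=
  LinearMap.prod
    ((Finsupp.lsum ℕ fun i : ℕ => lpow S.v i ∘ₗ S.δ₂) ∘ₗ
      LinearMap.fst R (ℕ →₀ S.Red.carrier) (ℕ → S.Red.carrier))
    (LinearMap.snd R (ℕ →₀ S.Red.carrier) (ℕ → S.Red.carrier))

/-- The coefficient of `xᵉ`, as a linear map `𝖱[[x⁻¹,x] → 𝖱`. -/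
noncomputable def coeffLM (S : SCData R) (e : ℤ) : barC S →ₗ[R] S.Red.carrier :=
  if 0 ≤ e then
    Finsupp.lapply e.toNat ∘ₗ LinearMap.fst R (ℕ →₀ S.Red.carrier) (ℕ → S.Red.carrier)
  else
    LinearMap.proj (-e - 1).toNat ∘ₗ LinearMap.snd R (ℕ →₀ S.Red.carrier) (ℕ → S.Red.carrier)

/-- `𝔍(C~) ⊆ 𝖱[[x⁻¹,x]`, the image of `i⋆ : Ĥ → 𝖱[[x⁻¹,x]` (equal to `𝔦(ker 𝔡̂)`). -/
noncomputable def Jmod (S : SCData R) : Submodule R (barC S) :=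
  (LinearMap.ker (hatD S)).map (mapI S)

/-- `J_i(C~) = { a₀ ∈ 𝖱 | ∃ a₀x^{-i} + a₋₁x^{-i-1} + ⋯ ∈ 𝔍(C~) }`. -/
noncomputable def Jset (S : SCData R) (i : ℤ) : Submodule R S.Red.carrier :=
  ((Jmod S) ⊓ ⨅ (e : ℤ) (_ : -i < e), LinearMap.ker (coeffLM S e)).map (coeffLM S (-i))

/-- The function `d_{C~}(i) = rk_R J_i(C~)`. -/
noncomputable def dFun (S : SCData R) (i : ℤ) : ℕ := Module.finrank R ↥(Jset S i)

theorem GradedMod.IsDeg.comp {L M N : GradedMod R} {k l m : ℤ}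
    {g : M.carrier →ₗ[R] N.carrier} {f : L.carrier →ₗ[R] M.carrier}
    (hg : M.IsDeg N l g) (hf : L.IsDeg M k f) (h : k + l = m) : L.IsDeg N m (g ∘ₗ f) := by
  rintro i _ ⟨x, hx, rfl⟩
  have hgf := hg _ ⟨f x, hf i ⟨x, hx, rfl⟩, rfl⟩
  rwa [add_assoc, h] at hgf

theorem GradedMod.IsDeg.add {M N : GradedMod R} {k : ℤ} {f g : M.carrier →ₗ[R] N.carrier}
    (hf : M.IsDeg N k f) (hg : M.IsDeg N k g) : M.IsDeg N k (f + g) := by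
  rintro i _ ⟨x, hx, rfl⟩
  exact add_mem (hf i ⟨x, hx, rfl⟩) (hg i ⟨x, hx, rfl⟩)

theorem GradedMod.IsDeg.zero {M N : GradedMod R} {k : ℤ} : M.IsDeg N k 0 := by
  rintro i _ ⟨x, -, rfl⟩
  exact zero_mem _

theorem GradedMod.IsDeg.mem {M N : GradedMod R} {k : ℤ} {f : M.carrier →ₗ[R] N.carrier}
    (hf : M.IsDeg N k f) {i j : ℤ} (h : i + k = j) {x : M.carrier} (hx : x ∈ M.grading i) :
    f x ∈ N.grading j :=
  h ▸ hf i ⟨x, hx, rfl⟩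

/-- A map into the irreducible summand of a suspension is homogeneous if its two components
are. -/
theorem GradedMod.IsDeg.prod_susp {M : GradedMod R} {S : SCData R} {k l m : ℤ}
    {f : M.carrier →ₗ[R] S.Irr.carrier} {g : M.carrier →ₗ[R] S.Red.carrier}
    (hf : M.IsDeg S.Irr k f) (hg : M.IsDeg S.Red l g) (hk : k = m - 2) (hl : l = m - 1) :
    M.IsDeg S.susp.Irr m (f.prod g) := by
  rintro i _ ⟨x, hx, rfl⟩
  exact ⟨hf.mem (by lia) hx, hg.mem (by lia) hx⟩

theorem SCData.isDeg_susp_fst (S : SCData R) :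
    S.susp.Irr.IsDeg S.Irr (-2) (LinearMap.fst R S.Irr.carrier S.Red.carrier) := by
  rintro i _ ⟨x, hx, rfl⟩
  exact hx.1

theorem SCData.isDeg_susp_snd (S : SCData R) :
    S.susp.Irr.IsDeg S.Red (-1) (LinearMap.snd R S.Irr.carrier S.Red.carrier) := by
  rintro i _ ⟨x, hx, rfl⟩
  exact hx.2

theorem SMap.DegreesAt.comp {S T U : SCData R} {g : SMap T U} {f : SMap S T} {k l : ℤ}
    (hg : g.DegreesAt l) (hf : f.DegreesAt k) : (g.comp f).DegreesAt (k + l) := by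
  obtain ⟨g₁, g₂, g₃, g₄, g₅⟩ := hg
  obtain ⟨f₁, f₂, f₃, f₄, f₅⟩ := hf
  exact ⟨g₁.comp f₁ rfl,
    ((g₁.comp f₂ (by ring)).add (g₂.comp f₁ (by ring))).add (g₄.comp f₃ (by ring)),
    (g₃.comp f₁ rfl).add (g₅.comp f₃ rfl),
    (g₁.comp f₄ (by ring)).add (g₄.comp f₅ (by ring)), g₅.comp f₅ rfl⟩

theorem SMap.IsMor.comp {S T U : SCData R} {g : SMap T U} {f : SMap S T}
    (hg : g.IsMor) (hf : f.IsMor) : (g.comp f).IsMor := by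
  simp only [SMap.IsMor, SMap.comp, LinearMap.ext_iff, LinearMap.add_apply, LinearMap.sub_apply,
    LinearMap.comp_apply, LinearMap.zero_apply, map_add] at hg hf ⊢
  obtain ⟨g₁, g₂, g₃, g₄, g₅⟩ := hg
  obtain ⟨f₁, f₂, f₃, f₄, f₅⟩ := hf
  refine ⟨fun x => ?_, fun x => ?_, fun x => ?_, fun x => ?_, fun x => ?_⟩
  · have h := congrArg g.lam (f₁ x)
    simp only [map_sub, map_zero] at h
    linear_combination (norm := module) h + g₁ (f.lam x)
  · have h := congrArg g.del1 (f₁ x)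
    have h' := congrArg g.rho (f₂ x)
    simp only [map_add, map_sub, map_zero] at h h'
    linear_combination (norm := module) -h + h' + g₂ (f.lam x) + g₅ (f.del1 x)
  · have h := congrArg g.lam (f₃ x)
    have h' := congrArg g.del2 (f₅ x)
    simp only [map_add, map_sub, map_zero] at h h'
    linear_combination (norm := module) h + h' + g₁ (f.del2 x) + g₃ (f.rho x)
  · have h := congrArg g.lam (f₄ x)
    have h' := congrArg g.mu (f₁ x)
    have h'' := congrArg g.del2 (f₂ x)
    simp only [map_add, map_sub, map_zero] at h h' h''
    linear_combination (norm := module)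
      h - h' + h'' + g₁ (f.mu x) + g₄ (f.lam x) + g₃ (f.del1 x)
  · have h := congrArg g.rho (f₅ x)
    simp only [map_sub, map_zero] at h
    linear_combination (norm := module) h + g₅ (f.rho x)

theorem hNegOneSusp_isMor {S T : SCData R} (hS : S.IsSComplex) (hSr : S.RPerfect)
    (hTr : T.RPerfect)
    {lam0 mu0 : S.Irr.carrier →ₗ[R] T.Irr.carrier} {del10 : S.Irr.carrier →ₗ[R] T.Red.carrier}
    {del20 : S.Red.carrier →ₗ[R] T.Irr.carrier} {tau0 taum1 : S.Red.carrier →ₗ[R] T.Red.carrier}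
    (rel1 : T.d ∘ₗ lam0 - lam0 ∘ₗ S.d - T.δ₂ ∘ₗ taum1 ∘ₗ S.δ₁ = 0)
    (rel2 : -(T.δ₁ ∘ₗ lam0) + del10 ∘ₗ S.d + taum1 ∘ₗ S.δ₁ ∘ₗ S.v + tau0 ∘ₗ S.δ₁ = 0)
    (rel3 : lam0 ∘ₗ S.δ₂ + T.d ∘ₗ del20 - T.v ∘ₗ T.δ₂ ∘ₗ taum1 - T.δ₂ ∘ₗ tau0 = 0)
    (rel4 : mu0 ∘ₗ S.d + T.d ∘ₗ mu0 + lam0 ∘ₗ S.v - T.v ∘ₗ lam0 + del20 ∘ₗ S.δ₁ -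
      T.δ₂ ∘ₗ del10 = 0) :
    (hNegOneSusp lam0 mu0 del10 del20 tau0 taum1).IsMor := by
  obtain ⟨-, -, -, -, hδd, -⟩ := hS
  obtain ⟨-, hr, hδδ⟩ := hSr
  obtain ⟨-, hr', hδδ'⟩ := hTr
  have hS₀ : ∀ x, S.δ₁ (S.δ₂ x) = 0 := LinearMap.congr_fun (hδδ 0)
  have hT₀ : ∀ x, T.δ₁ (T.δ₂ x) = 0 := LinearMap.congr_fun (hδδ' 0)
  have hd : ∀ x, S.δ₁ (S.d x) = 0 := by
    rw [hr, LinearMap.zero_comp, add_zero] at hδd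
    exact LinearMap.congr_fun hδd
  simp only [LinearMap.ext_iff, LinearMap.add_apply, LinearMap.sub_apply, LinearMap.neg_apply,
    LinearMap.comp_apply, LinearMap.zero_apply] at rel1 rel2 rel3 rel4
  refine ⟨LinearMap.ext fun x => Prod.ext ?_ ?_, LinearMap.ext fun x => ?_,
    LinearMap.ext fun x => Prod.ext ?_ ?_, LinearMap.ext fun x => Prod.ext ?_ ?_,
    LinearMap.ext fun x => ?_⟩
  · change T.d (lam0 x) - T.δ₂ (taum1 (S.δ₁ x)) - lam0 (S.d x) = 0
    linear_combination (norm := module) rel1 x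
  · change -T.r (taum1 (S.δ₁ x)) - taum1 (S.δ₁ (S.d x)) = 0
    simp [hr', hd]
  · change 0 + taum1 (S.δ₁ x) - taum1 (S.δ₁ x) - T.r 0 = 0
    simp
  · change T.d (del20 x) - T.δ₂ (tau0 x) - T.v (T.δ₂ (taum1 x)) + lam0 (S.δ₂ x) +
      del20 (S.r x) = 0
    simp only [hr, LinearMap.zero_apply, map_zero]
    linear_combination (norm := module) rel3 x
  · change -T.r (tau0 x) - T.δ₁ (T.δ₂ (taum1 x)) + taum1 (S.δ₁ (S.δ₂ x)) + tau0 (S.r x) = 0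
    simp [hr, hr', hS₀, hT₀]
  · change mu0 (S.d x) + (T.d (mu0 x) - T.δ₂ (del10 x)) + lam0 (S.v x) - T.v (lam0 x) +
      del20 (S.δ₁ x) - T.v (T.δ₂ 0) = 0
    simp only [map_zero]
    linear_combination (norm := module) rel4 x
  · change del10 (S.d x) + -T.r (del10 x) + taum1 (S.δ₁ (S.v x)) - T.δ₁ (lam0 x) +
      tau0 (S.δ₁ x) - T.δ₁ (T.δ₂ 0) = 0
    simp only [hr', LinearMap.zero_apply, map_zero]
    linear_combination (norm := module) rel2 x
  · change taum1 (S.r x) - T.r (taum1 x) = 0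
    simp [hr, hr']

theorem hNegOneSusp_degreesAt {S T : SCData R} (hS : S.IsSComplex) {k : ℤ}
    {lam0 mu0 : S.Irr.carrier →ₗ[R] T.Irr.carrier} {del10 : S.Irr.carrier →ₗ[R] T.Red.carrier}
    {del20 : S.Red.carrier →ₗ[R] T.Irr.carrier} {tau0 taum1 : S.Red.carrier →ₗ[R] T.Red.carrier}
    (hlam : S.Irr.IsDeg T.Irr k lam0) (hmu : S.Irr.IsDeg T.Irr (k - 1) mu0)
    (hdel1 : S.Irr.IsDeg T.Red k del10) (hdel2 : S.Red.IsDeg T.Irr (k - 1) del20)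
    (htau0 : S.Red.IsDeg T.Red k tau0) (htaum1 : S.Red.IsDeg T.Red (k + 2) taum1) :
    (hNegOneSusp lam0 mu0 del10 del20 tau0 taum1).DegreesAt (k + 2) := by
  obtain ⟨-, -, ⟨-, -, hδ₁, -, -⟩, -⟩ := hS
  exact ⟨hlam.prod_susp (htaum1.comp hδ₁ rfl) (by ring) (by ring),
    hmu.prod_susp hdel1 (by ring) (by ring), .zero,
    hdel2.prod_susp htau0 (by ring) (by ring), htaum1⟩

theorem lambdaSecond_isMor {S T : SCData R} (hS : S.IsSComplex) (hSr : S.RPerfect)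
    (hT : T.IsSComplex) (hTr : T.RPerfect) {f : SMap S T} (hf : f.IsMor) (hrho : f.rho = 0)
    (ha : T.δ₁ ∘ₗ f.del2 = 0) (hb : f.del1 ∘ₗ S.δ₂ = 0)
    (nu : S.Red.carrier →ₗ[R] T.Red.carrier) : (lambdaSecond f nu).IsMor := by
  obtain ⟨-, -, -, -, -, hS₃, -, -⟩ := hS
  obtain ⟨-, -, -, -, -, hT₃, hT₄, -⟩ := hT
  obtain ⟨-, hr, hδδ⟩ := hSr
  obtain ⟨-, hr', -⟩ := hTr
  have hδ : ∀ x, S.δ₁ (S.δ₂ x) = 0 := LinearMap.congr_fun (hδδ 0)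
  simp only [SMap.IsMor, hr, hr', hrho, LinearMap.ext_iff, LinearMap.add_apply,
    LinearMap.sub_apply, LinearMap.comp_apply, LinearMap.zero_apply, map_zero, add_zero,
    sub_zero] at hS₃ hT₃ hT₄ hf ha hb
  obtain ⟨f₁, f₂, f₃, f₄, -⟩ := hf
  refine ⟨LinearMap.ext fun ⟨x, y⟩ => ?_, LinearMap.ext fun ⟨x, y⟩ => ?_,
    LinearMap.ext fun (x : S.Red.carrier) => ?_, LinearMap.ext fun ⟨x, y⟩ => ?_,
    LinearMap.ext fun (x : S.Red.carrier) => ?_⟩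
  · change T.d (f.lam x + f.del2 y) - (f.lam (S.d x - S.δ₂ y) + f.del2 (-S.r y)) = 0
    simp only [hr, LinearMap.zero_apply, map_add, map_sub, map_neg, map_zero]
    linear_combination (norm := module) f₁ x + f₃ y
  · change f.del1 (S.d x - S.δ₂ y) + nu (-S.r y) + 0 - T.δ₁ (f.lam x + f.del2 y) -
      T.r (f.del1 x + nu y) = 0
    simp only [hr, hr', ha, hb, LinearMap.zero_apply, map_add, map_sub, map_neg, map_zero]
    linear_combination (norm := module) f₂ x
  · change T.d (f.mu (S.δ₂ x) + T.v (f.del2 x) + T.δ₂ (nu x)) - T.δ₂ 0 +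
      (f.lam (S.v (S.δ₂ x)) + f.del2 (S.δ₁ (S.δ₂ x))) +
      (f.mu (S.δ₂ (S.r x)) + T.v (f.del2 (S.r x)) + T.δ₂ (nu (S.r x))) = 0
    have h := f₄ (S.δ₂ x)
    have h' := hT₄ (f.del2 x)
    have h'' := congrArg T.v (f₃ x)
    simp only [hr, hS₃, hδ, hb, ha, hT₃, LinearMap.zero_apply, map_add, map_zero] at h h' h'' ⊢
    linear_combination (norm := module) h + h' + h''
  · change f.mu (S.d x - S.δ₂ y) + T.d (f.mu x) + (f.lam (S.v x) + f.del2 (S.δ₁ x)) -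
      T.v (f.lam x + f.del2 y) + (f.mu (S.δ₂ y) + T.v (f.del2 y) + T.δ₂ (nu y)) -
      T.δ₂ (f.del1 x + nu y) = 0
    simp only [map_add, map_sub]
    linear_combination (norm := module) f₄ x
  · change 0 - T.r 0 = 0
    simp

theorem lambdaSecond_degreesAt {S T : SCData R} (hS : S.IsSComplex) (hT : T.IsSComplex)
    {f : SMap S T} {k : ℤ} (hf : f.DegreesAt k) {nu : S.Red.carrier →ₗ[R] T.Red.carrier}
    (hnu : S.Red.IsDeg T.Red (k - 1) nu) : (lambdaSecond f nu).DegreesAt (k - 2) := by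
  obtain ⟨-, -, ⟨-, -, -, hδ₂, -⟩, -⟩ := hS
  obtain ⟨-, -, ⟨-, hv, -, hδ₂', -⟩, -⟩ := hT
  obtain ⟨f₁, f₂, f₃, f₄, -⟩ := hf
  have hfst := S.isDeg_susp_fst
  have hsnd := S.isDeg_susp_snd
  exact ⟨(f₁.comp hfst (by ring)).add (f₄.comp hsnd (by ring)), f₂.comp hfst (by ring),
    (f₃.comp hfst (by ring)).add (hnu.comp hsnd (by ring)),
    ((f₂.comp hδ₂ (by ring)).add (hv.comp f₄ (by ring))).add (hδ₂'.comp hnu (by ring)), .zero⟩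

/-- Height `−1` morphism data `(λ, μ, Δ₁, Δ₂, τ₀, τ₋₁) : C~ → C~'` gives a
morphism `λ~₁ : C~ → ΣC~'`, and the composite with the morphism `λ~'' : ΣC~' → C~''`
associated to an odd-degree morphism `(λ~', ν')` is the odd-degree morphism of `S`-complexes
with components `λ° = λ'λ + Δ₂'τ₋₁δ₁`, `μ° = λ'μ + μ'λ + Δ₂'Δ₁`, `Δ₁° = Δ₁'λ + ν'τ₋₁δ₁`,
`Δ₂° = λ'Δ₂ + Δ₂'τ₀ + δ₂''ν'τ₋₁ + v''Δ₂'τ₋₁ + μ'δ₂'τ₋₁` and `ρ° = 0`. -/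
theorem heightNegOne_comp_odd {R : Type u} [CommRing R] {S S' S'' : SCData R}
    (hS : S.IsSComplex) (hSr : S.RPerfect) (hS' : S'.IsSComplex) (hS'r : S'.RPerfect)
    (hS'' : S''.IsSComplex) (hS''r : S''.RPerfect)
    (k : ℤ) (hk : Even k)
    (lam0 mu0 : S.Irr.carrier →ₗ[R] S'.Irr.carrier)
    (del10 : S.Irr.carrier →ₗ[R] S'.Red.carrier)
    (del20 : S.Red.carrier →ₗ[R] S'.Irr.carrier)
    (tau0 taum1 : S.Red.carrier →ₗ[R] S'.Red.carrier)
    (hdl : S.Irr.IsDeg S'.Irr k lam0) (hdm : S.Irr.IsDeg S'.Irr (k - 1) mu0)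
    (hdd1 : S.Irr.IsDeg S'.Red k del10) (hdd2 : S.Red.IsDeg S'.Irr (k - 1) del20)
    (hdt0 : S.Red.IsDeg S'.Red k tau0) (hdt1 : S.Red.IsDeg S'.Red (k + 2) taum1)
    (rel1 : S'.d ∘ₗ lam0 - lam0 ∘ₗ S.d - S'.δ₂ ∘ₗ taum1 ∘ₗ S.δ₁ = 0)
    (rel2 : -(S'.δ₁ ∘ₗ lam0) + del10 ∘ₗ S.d + taum1 ∘ₗ S.δ₁ ∘ₗ S.v + tau0 ∘ₗ S.δ₁ = 0)
    (rel3 : lam0 ∘ₗ S.δ₂ + S'.d ∘ₗ del20 - S'.v ∘ₗ S'.δ₂ ∘ₗ taum1 - S'.δ₂ ∘ₗ tau0 = 0)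
    (rel4 : mu0 ∘ₗ S.d + S'.d ∘ₗ mu0 + lam0 ∘ₗ S.v - S'.v ∘ₗ lam0 + del20 ∘ₗ S.δ₁ -
      S'.δ₂ ∘ₗ del10 = 0)
    (f' : SMap S' S'') (hf' : f'.IsMor) (k' : ℤ) (hk' : Odd k') (hdeg' : f'.DegreesAt k')
    (hrho' : f'.rho = 0) (ha : S''.δ₁ ∘ₗ f'.del2 = 0) (hb : f'.del1 ∘ₗ S'.δ₂ = 0)
    (nu : S'.Red.carrier →ₗ[R] S''.Red.carrier) (hnu : S'.Red.IsDeg S''.Red (k' - 1) nu) :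
    (hNegOneSusp lam0 mu0 del10 del20 tau0 taum1).IsMor ∧
    (hNegOneSusp lam0 mu0 del10 del20 tau0 taum1).DegreesAt (k + 2) ∧
    ((lambdaSecond f' nu).comp (hNegOneSusp lam0 mu0 del10 del20 tau0 taum1) =
      { lam := f'.lam ∘ₗ lam0 + f'.del2 ∘ₗ taum1 ∘ₗ S.δ₁
        mu := f'.lam ∘ₗ mu0 + f'.mu ∘ₗ lam0 + f'.del2 ∘ₗ del10
        del1 := f'.del1 ∘ₗ lam0 + nu ∘ₗ taum1 ∘ₗ S.δ₁
        del2 := f'.lam ∘ₗ del20 + f'.del2 ∘ₗ tau0 + S''.δ₂ ∘ₗ nu ∘ₗ taum1 +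
          S''.v ∘ₗ f'.del2 ∘ₗ taum1 + f'.mu ∘ₗ S'.δ₂ ∘ₗ taum1
        rho := 0 }) ∧
    SMap.IsMor ((lambdaSecond f' nu).comp (hNegOneSusp lam0 mu0 del10 del20 tau0 taum1)) ∧
    SMap.DegreesAt ((lambdaSecond f' nu).comp (hNegOneSusp lam0 mu0 del10 del20 tau0 taum1))
      (k + k') := by
  have hmor := hNegOneSusp_isMor hS hSr hS'r rel1 rel2 rel3 rel4
  have hdeg := hNegOneSusp_degreesAt hS hdl hdm hdd1 hdd2 hdt0 hdt1
  refine ⟨hmor, hdeg, ?_, (lambdaSecond_isMor hS' hS'r hS'' hS''r hf' hrho' ha hb nu).comp hmor, ?_⟩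
  · simp only [SMap.comp, lambdaSecond, hNegOneSusp, SMap.mk.injEq]
    refine ⟨rfl, LinearMap.ext fun x => ?_, LinearMap.ext fun x => ?_, LinearMap.ext fun x => ?_,
      rfl⟩
    · change f'.lam (mu0 x) + f'.del2 (del10 x) + f'.mu (lam0 x) +
        (f'.mu (S'.δ₂ 0) + S''.v (f'.del2 0) + S''.δ₂ (nu 0)) =
        f'.lam (mu0 x) + f'.mu (lam0 x) + f'.del2 (del10 x)
      simp only [map_zero]
      abel
    · exact add_zero (f'.del1 (lam0 x) + nu (taum1 (S.δ₁ x)))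
    · change f'.lam (del20 x) + f'.del2 (tau0 x) +
        (f'.mu (S'.δ₂ (taum1 x)) + S''.v (f'.del2 (taum1 x)) + S''.δ₂ (nu (taum1 x))) =
        f'.lam (del20 x) + f'.del2 (tau0 x) + S''.δ₂ (nu (taum1 x)) +
          S''.v (f'.del2 (taum1 x)) + f'.mu (S'.δ₂ (taum1 x))
      abel
  · have h := (lambdaSecond_degreesAt hS' hS'' hdeg' hnu).comp hdeg
    rwa [show k + 2 + (k' - 2) = k + k' by ring] at h
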